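/- Let n = 2m be even and let L₀ be the Chetwynd–Häggkvist square of order n. Let κ > 0, d > 0, ε ≥ 0 be reals and a a nonnegative integer, and assume 3 ≤ n − 4(κ/d)n − 6dn − 6εn − 3a and 12 ≤ n − 12dn − 12εn − 4a. Let L be a latin square of order n that differs from L₀ in at most κn² cells, let P be an ε-dense partial latin square of order n, and let T be a set of a symbols. Then for every row r₁ there is a set C₁ of columns with |C₁| ≤ 2(κ/d)n + εn + a such that for every column c₁ ∉ C₁ there is a set C₂ of columns with |C₂| ≤ 4(κ/d)n + 2dn + 3εn + a + 1 such that for every column c₂ ∉ C₂ there exists a latin square L' of order n satisfying: (i) L' differs from L in at most 16 cells; (ii) L' i j = L i j at every cell (i,j) with P i j = some (L i j); (iii) at every cell (i,j) where L' i j ≠ L i j, neither L i j nor L' i j belongs to T; (iv) L' r₁ c₁ = L r₁ c₂, L' r₁ c₂ = L r₁ c₁, and L' r₁ c = L r₁ c for every column c ∉ {c₁, c₂}. -/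

import Mathlib

/-- The Chetwynd–Häggkvist square of order `n = 2*m` (0-indexed):
`(j-i) % m` in the top-left quadrant, `(i-j) % m` in the bottom-right,
`m + (j-i) % m` in the top-right, `m + (i-j) % m` in the bottom-left. -/
def CHsq (m : ℕ) (i j : Fin (2 * m)) : Fin (2 * m) :=
  have hm : 0 < m := by have := i.isLt; omega
  if i.val < m then
    if j.val < m then
      ⟨(j.val + 2 * m - i.val) % m, by have := Nat.mod_lt (j.val + 2 * m - i.val) hm; omega⟩
    else
      ⟨m + (j.val + 2 * m - i.val) % m, by have := Nat.mod_lt (j.val + 2 * m - i.val) hm; omega⟩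
  else
    if j.val < m then
      ⟨m + (i.val + 2 * m - j.val) % m, by have := Nat.mod_lt (i.val + 2 * m - j.val) hm; omega⟩
    else
      ⟨(i.val + 2 * m - j.val) % m, by have := Nat.mod_lt (i.val + 2 * m - j.val) hm; omega⟩

/-- A partial latin square of order `n`: each symbol occurs at most once in
each row and at most once in each column. -/
def IsPartialLatinSquare {n : ℕ} (P : Fin n → Fin n → Option (Fin n)) : Prop :=
  (∀ i j j' s, P i j = some s → P i j' = some s → j = j') ∧
  (∀ i i' j s, P i j = some s → P i' j = some s → i = i')

/-- `P` is `ε`-dense: every row, column, and symbol of `P` has at most `ε * n`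
filled cells. -/
def IsEpsDense {n : ℕ} (ε : ℝ) (P : Fin n → Fin n → Option (Fin n)) : Prop :=
  (∀ i, ((Finset.univ.filter fun j => (P i j).isSome).card : ℝ) ≤ ε * n) ∧
  (∀ j, ((Finset.univ.filter fun i => (P i j).isSome).card : ℝ) ≤ ε * n) ∧
  (∀ s, ((Finset.univ.filter fun p : Fin n × Fin n => P p.1 p.2 = some s).card : ℝ) ≤ ε * n)

/-- A latin square of order `n`: every row and every column contains each
symbol exactly once. -/
def IsLatinSquare {n : ℕ} (L : Fin n → Fin n → Fin n) : Prop :=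
  (∀ i, Function.Bijective (L i)) ∧ (∀ j, Function.Bijective fun i => L i j)

/-- `L` completes `P`. -/
def Completes {n : ℕ} (L : Fin n → Fin n → Fin n)
    (P : Fin n → Fin n → Option (Fin n)) : Prop :=
  ∀ i j s, P i j = some s → L i j = s

/-- The number of filled cells of a partial latin square. -/
def filledCells {n : ℕ} (P : Fin n → Fin n → Option (Fin n)) : ℕ :=
  (Finset.univ.filter fun p : Fin n × Fin n => P p.1 p.2 ≠ none).card


/-! ### Facts on the Chetwynd–Häggkvist square -/

lemma CH_mod_spec (m a : ℕ) (hm : 0 < m) (ha : a < 4 * m) :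
    a % m < m ∧ (a = a % m ∨ a = a % m + m ∨ a = a % m + 2 * m ∨ a = a % m + 3 * m) := by
  refine ⟨Nat.mod_lt _ hm, ?_⟩
  have h := Nat.div_add_mod a m
  have h4 : a / m < 4 := by rw [Nat.div_lt_iff_lt_mul hm]; omega
  interval_cases hq : a / m <;> omega

lemma CH_half (m : ℕ) (i j : Fin (2 * m)) :
    ((CHsq m i j).val < m ↔ (i.val < m ↔ j.val < m)) := by
  have hm : 0 < m := by have := i.isLt; omega
  have h1 := Nat.mod_lt (j.val + 2 * m - i.val) hm
  have h2 := Nat.mod_lt (i.val + 2 * m - j.val) hm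
  unfold CHsq
  by_cases hi : i.val < m <;> by_cases hj : j.val < m <;> simp [hi, hj, h1, h2]

lemma CH_mod_core (m i i' j j' : ℕ) (hi : i < 2 * m) (hj : j < 2 * m) (hj' : j' < 2 * m)
    (h : (j' + 2 * m - i) % m = (i' + 2 * m - j) % m) :
    (j + 2 * m - i) % m = (i' + 2 * m - j') % m := by
  have h1 : (j' + 2 * m - i) + j ≡ (i' + 2 * m - j) + j [MOD m] := Nat.ModEq.add_right _ h
  have e1 : (j' + 2 * m - i) + j = (j + 2 * m - i) + j' := by omega
  have e2 : (i' + 2 * m - j) + j = (i' + 2 * m - j') + j' := by omega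
  rw [e1, e2] at h1
  exact Nat.ModEq.add_right_cancel' j' h1

lemma CH_intercalate (m : ℕ) (i i' j j' : Fin (2 * m))
    (hi : ¬ (i.val < m ↔ i'.val < m)) (hj : ¬ (j.val < m ↔ j'.val < m))
    (h : CHsq m i j' = CHsq m i' j) : CHsq m i j = CHsq m i' j' := by
  have c1 := CH_mod_core m i i' j j' i.2 j.2 j'.2
  have c2 := CH_mod_core m i' i j' j i'.2 j'.2 j.2
  unfold CHsq at *
  by_cases g1 : i.val < m <;> by_cases g2 : i'.val < m <;> by_cases g3 : j.val < m <;>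
    by_cases g4 : j'.val < m <;> simp [g1, g2, g3, g4] at h hi hj ⊢
  · exact c1 h
  · exact c1 h
  · exact (c2 h.symm).symm
  · exact (c2 h.symm).symm

lemma CH_inj (m : ℕ) (i j j' : Fin (2 * m)) (h : CHsq m i j = CHsq m i j') : j = j' := by
  have hm : 0 < m := by have := i.isLt; omega
  have a1 := CH_mod_spec m (j.val + 2 * m - i.val) hm (by omega)
  have a2 := CH_mod_spec m (i.val + 2 * m - j.val) hm (by omega)
  have a3 := CH_mod_spec m (j'.val + 2 * m - i.val) hm (by omega)
  have a4 := CH_mod_spec m (i.val + 2 * m - j'.val) hm (by omega)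
  unfold CHsq at *
  by_cases g1 : i.val < m <;> by_cases g3 : j.val < m <;>
    by_cases g4 : j'.val < m <;> simp [g1, g3, g4] at h <;> omega

/-! ### Switching intercalates -/

lemma swap_intercalate {n : ℕ} (M : Fin n → Fin n → Fin n) (hM : IsLatinSquare M)
    (i i' j j' s s' : Fin n) (hi : i ≠ i') (hj : j ≠ j')
    (h1 : M i j = s) (h2 : M i j' = s') (h3 : M i' j = s') (h4 : M i' j' = s) :
    ∃ M' : Fin n → Fin n → Fin n, IsLatinSquare M' ∧
      M' i j = s' ∧ M' i j' = s ∧ M' i' j = s ∧ M' i' j' = s' ∧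
      ∀ a b, ¬ ((a = i ∨ a = i') ∧ (b = j ∨ b = j')) → M' a b = M a b := by
  classical
  let M' : Fin n → Fin n → Fin n := fun a b =>
    if a = i ∨ a = i' then M a (Equiv.swap j j' b) else M a b
  have hM' : ∀ a b, M' a b = if b = j ∨ b = j' then M (Equiv.swap i i' a) b else M a b := by
    intro a b
    simp only [M', Equiv.swap_apply_def]
    split_ifs <;> grind
  refine ⟨M', ⟨?_, ?_⟩, ?_, ?_, ?_, ?_, ?_⟩
  · intro a
    by_cases h : a = i ∨ a = i'
    · have : M' a = M a ∘ Equiv.swap j j' := by funext b; simp [M', h]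
      rw [this]; exact (hM.1 a).comp (Equiv.bijective _)
    · have : M' a = M a := by funext b; simp [M', h]
      rw [this]; exact hM.1 a
  · intro b
    by_cases h : b = j ∨ b = j'
    · have : (fun a => M' a b) = (fun a => M a b) ∘ Equiv.swap i i' := by
        funext a; simp [hM', h]
      rw [this]; exact (hM.2 b).comp (Equiv.bijective _)
    · have : (fun a => M' a b) = fun a => M a b := by funext a; simp [hM', h]
      rw [this]; exact hM.2 b
  · simp [M', h2]
  · simp [M', h1]
  · simp [M', h4]
  · simp [M', h3]
  · intro a b h
    simp only [M', Equiv.swap_apply_def]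
    split_ifs <;> grind

/-- `M` is a latin square that differs from `L` only in the cells of `S`, where it avoids `T`. -/
def TradeInv {n : ℕ} (L : Fin n → Fin n → Fin n) (S : Finset (Fin n × Fin n))
    (T : Finset (Fin n)) (M : Fin n → Fin n → Fin n) : Prop :=
  IsLatinSquare M ∧ ∀ a b, M a b ≠ L a b → (a, b) ∈ S ∧ M a b ∉ T

lemma swap_step {n : ℕ} {L : Fin n → Fin n → Fin n} {S : Finset (Fin n × Fin n)}
    {T : Finset (Fin n)} {M : Fin n → Fin n → Fin n} (hM : TradeInv L S T M)
    (i i' j j' s s' : Fin n) (hi : i ≠ i') (hj : j ≠ j')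
    (h1 : M i j = s) (h2 : M i j' = s') (h3 : M i' j = s') (h4 : M i' j' = s)
    (hs : s ∉ T) (hs' : s' ∉ T)
    (m1 : (i, j) ∈ S) (m2 : (i, j') ∈ S) (m3 : (i', j) ∈ S) (m4 : (i', j') ∈ S) :
    ∃ M' : Fin n → Fin n → Fin n, TradeInv L S T M' ∧
      M' i j = s' ∧ M' i j' = s ∧ M' i' j = s ∧ M' i' j' = s' ∧
      ∀ a b, ¬ ((a = i ∨ a = i') ∧ (b = j ∨ b = j')) → M' a b = M a b := by
  obtain ⟨M', l, e1, e2, e3, e4, e5⟩ := swap_intercalate M hM.1 i i' j j' s s' hi hj h1 h2 h3 h4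
  refine ⟨M', ⟨l, ?_⟩, e1, e2, e3, e4, e5⟩
  intro a b hab
  by_cases h : (a = i ∨ a = i') ∧ (b = j ∨ b = j')
  · obtain ⟨ha | ha, hb | hb⟩ := h <;> subst ha <;> subst hb
    · rw [e1]; exact ⟨m1, hs'⟩
    · rw [e2]; exact ⟨m2, hs⟩
    · rw [e3]; exact ⟨m3, hs⟩
    · rw [e4]; exact ⟨m4, hs'⟩
  · rw [e5 a b h] at hab ⊢
    exact hM.2 a b hab

/-- The conclusion of the lemma for one pair of columns. -/
def GoodSwap {n : ℕ} (L : Fin n → Fin n → Fin n) (P : Fin n → Fin n → Option (Fin n))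
    (T : Finset (Fin n)) (r₁ c₁ c₂ : Fin n) : Prop :=
  ∃ L' : Fin n → Fin n → Fin n,
    IsLatinSquare L' ∧
    (Finset.univ.filter fun p : Fin n × Fin n => L' p.1 p.2 ≠ L p.1 p.2).card ≤ 16 ∧
    (∀ i j, P i j = some (L i j) → L' i j = L i j) ∧
    (∀ i j, L' i j ≠ L i j → L i j ∉ T ∧ L' i j ∉ T) ∧
    L' r₁ c₁ = L r₁ c₂ ∧ L' r₁ c₂ = L r₁ c₁ ∧
    ∀ c, c ≠ c₁ → c ≠ c₂ → L' r₁ c = L r₁ c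

lemma GoodSwap.symm {n : ℕ} {L : Fin n → Fin n → Fin n} {P : Fin n → Fin n → Option (Fin n)}
    {T : Finset (Fin n)} {r₁ c₁ c₂ : Fin n} (h : GoodSwap L P T r₁ c₁ c₂) :
    GoodSwap L P T r₁ c₂ c₁ := by
  obtain ⟨L', a1, a2, a3, a4, a5, a6, a7⟩ := h
  exact ⟨L', a1, a2, a3, a4, a6, a5, fun c h h' => a7 c h' h⟩

lemma GoodSwap.of_inv {n : ℕ} {L : Fin n → Fin n → Fin n} {P : Fin n → Fin n → Option (Fin n)}
    {T : Finset (Fin n)} {r₁ c₁ c₂ : Fin n} {S : Finset (Fin n × Fin n)}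
    (hS : S.card ≤ 16)
    (hP : ∀ p ∈ S, P p.1 p.2 ≠ some (L p.1 p.2) ∧ L p.1 p.2 ∉ T)
    {M : Fin n → Fin n → Fin n} (hM : TradeInv L S T M)
    (e1 : M r₁ c₁ = L r₁ c₂) (e2 : M r₁ c₂ = L r₁ c₁)
    (e3 : ∀ c, c ≠ c₁ → c ≠ c₂ → M r₁ c = L r₁ c) : GoodSwap L P T r₁ c₁ c₂ := by
  refine ⟨M, hM.1, ?_, ?_, ?_, e1, e2, e3⟩
  · refine le_trans (Finset.card_le_card ?_) hS
    intro p hp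
    exact (hM.2 p.1 p.2 (by simpa using hp)).1
  · intro i j h
    by_contra h'
    exact (hP _ (hM.2 i j h').1).1 h
  · intro i j h
    exact ⟨(hP _ (hM.2 i j h).1).2, (hM.2 i j h).2⟩

/-- The trade on 10 cells. -/
lemma trade_ten {n : ℕ} (L : Fin n → Fin n → Fin n) (hL : IsLatinSquare L)
    (P : Fin n → Fin n → Option (Fin n)) (T : Finset (Fin n))
    (r₁ c₁ c₂ p q r e f s₁ s₂ x y : Fin n)
    (v1 : L r₁ c₁ = s₁) (v2 : L r₁ c₂ = s₂) (v3 : L p c₁ = s₂) (v4 : L q c₂ = s₁)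
    (v5 : L r c₁ = x) (v6 : L r c₂ = y) (v7 : L r e = s₂) (v8 : L r f = s₁)
    (v9 : L p e = x) (v10 : L q f = y)
    (t1 : s₁ ∉ T) (t2 : s₂ ∉ T) (t3 : x ∉ T) (t4 : y ∉ T)
    (n1 : r ≠ r₁) (n2 : p ≠ r₁) (n3 : q ≠ r₁) (n4 : r ≠ p) (n5 : r ≠ q)
    (n6 : c₁ ≠ c₂) (n7 : e ≠ c₁) (n8 : e ≠ c₂) (n9 : f ≠ c₁) (n10 : f ≠ c₂) (n11 : e ≠ f)
    (b1 : P r₁ c₁ ≠ some (L r₁ c₁)) (b2 : P r₁ c₂ ≠ some (L r₁ c₂))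
    (b3 : P p c₁ ≠ some (L p c₁)) (b4 : P q c₂ ≠ some (L q c₂))
    (b5 : P r c₁ ≠ some (L r c₁)) (b6 : P r c₂ ≠ some (L r c₂))
    (b7 : P r e ≠ some (L r e)) (b8 : P r f ≠ some (L r f))
    (b9 : P p e ≠ some (L p e)) (b10 : P q f ≠ some (L q f)) :
    GoodSwap L P T r₁ c₁ c₂ := by
  classical
  let l : List (Fin n × Fin n) :=
    [(r₁, c₁), (r₁, c₂), (p, c₁), (q, c₂), (r, c₁), (r, c₂), (r, e), (r, f), (p, e), (q, f)]
  have hS : l.toFinset.card ≤ 16 := le_trans (List.toFinset_card_le l) (by simp [l])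
  have h0 : TradeInv L l.toFinset T L := ⟨hL, fun a b h => absurd rfl h⟩
  obtain ⟨M1, i1, o11, -, -, -, k1⟩ := swap_step h0 r p c₁ e x s₂ n4 n7.symm v5 v7 v3 v9 t3 t2
      (by simp [l]) (by simp [l]) (by simp [l]) (by simp [l])
  obtain ⟨M2, i2, o21, -, -, -, k2⟩ := swap_step i1 r q c₂ f y s₁ n5 n10.symm
    (by grind) (by grind) (by grind) (by grind) t4 t1
    (by simp [l]) (by simp [l]) (by simp [l]) (by simp [l])
  obtain ⟨M3, i3, o31, o32, -, -, k3⟩ := swap_step i2 r₁ r c₁ c₂ s₁ s₂ n1.symm n6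
    (by grind) (by grind) (by grind) (by grind) t1 t2
    (by simp [l]) (by simp [l]) (by simp [l]) (by simp [l])
  refine GoodSwap.of_inv hS ?_ i3 (by grind) (by grind) (by grind)
  simp only [l, List.mem_toFinset, List.forall_mem_cons]
  simp [v1, v2, v3, v4, v5, v6, v7, v8, v9, v10] at *
  simp [*]

/-- The trade on 16 cells. -/
lemma trade_sixteen {n : ℕ} (L : Fin n → Fin n → Fin n) (hL : IsLatinSquare L)
    (P : Fin n → Fin n → Option (Fin n)) (T : Finset (Fin n))
    (r₁ c₁ c₂ p q r e f g c t k s₁ s₂ x y u v : Fin n)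
    (v1 : L r₁ c₁ = s₁) (v2 : L r₁ c₂ = s₂) (v3 : L p c₁ = s₂) (v4 : L q c₂ = s₁)
    (v5 : L r c₁ = x) (v6 : L r c₂ = y) (v7 : L r e = s₂) (v8 : L r f = s₁)
    (v9 : L p g = x) (v10 : L q f = y) (v11 : L r c = u) (v12 : L p c = v)
    (v13 : L t c = s₂) (v14 : L t e = u) (v15 : L k c = x) (v16 : L k g = v)
    (t1 : s₁ ∉ T) (t2 : s₂ ∉ T) (t3 : x ∉ T) (t4 : y ∉ T) (t5 : u ∉ T) (t6 : v ∉ T)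
    (n1 : r ≠ r₁) (n2 : p ≠ r₁) (n3 : q ≠ r₁) (n4 : r ≠ p) (n5 : r ≠ q) (n12 : p ≠ q)
    (n13 : t ≠ r₁) (n14 : k ≠ r₁) (n15 : t ≠ r) (n16 : k ≠ p) (n17 : k ≠ r) (n18 : k ≠ t)
    (n19 : p ≠ t) (n20 : k ≠ q)
    (n6 : c₁ ≠ c₂) (n7 : e ≠ c₁) (n8 : e ≠ c₂) (n9 : f ≠ c₁) (n10 : f ≠ c₂) (n11 : e ≠ f)
    (n21 : g ≠ c₁) (n22 : c ≠ c₁) (n23 : c ≠ c₂) (n24 : c ≠ e) (n25 : c ≠ f) (n26 : c ≠ g)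
    (b1 : P r₁ c₁ ≠ some (L r₁ c₁)) (b2 : P r₁ c₂ ≠ some (L r₁ c₂))
    (b3 : P p c₁ ≠ some (L p c₁)) (b4 : P q c₂ ≠ some (L q c₂))
    (b5 : P r c₁ ≠ some (L r c₁)) (b6 : P r c₂ ≠ some (L r c₂))
    (b7 : P r e ≠ some (L r e)) (b8 : P r f ≠ some (L r f))
    (b9 : P p g ≠ some (L p g)) (b10 : P q f ≠ some (L q f))
    (b11 : P r c ≠ some (L r c)) (b12 : P p c ≠ some (L p c))
    (b13 : P t c ≠ some (L t c)) (b14 : P t e ≠ some (L t e))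
    (b15 : P k c ≠ some (L k c)) (b16 : P k g ≠ some (L k g)) :
    GoodSwap L P T r₁ c₁ c₂ := by
  classical
  let l : List (Fin n × Fin n) :=
    [(r₁, c₁), (r₁, c₂), (p, c₁), (q, c₂), (r, c₁), (r, c₂), (r, e), (r, f), (p, g), (q, f),
      (r, c), (p, c), (t, c), (t, e), (k, c), (k, g)]
  have hS : l.toFinset.card ≤ 16 := le_trans (List.toFinset_card_le l) (by simp [l])
  have h0 : TradeInv L l.toFinset T L := ⟨hL, fun a b h => absurd rfl h⟩
  obtain ⟨M1, i1, o11, -, -, -, k1⟩ := swap_step h0 r t c e u s₂ n15.symm n24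
    v11 v7 v13 v14 t5 t2
    (by simp [l]) (by simp [l]) (by simp [l]) (by simp [l])
  obtain ⟨M2, i2, o21, -, -, -, k2⟩ := swap_step i1 p k c g v x n16.symm n26
    (by grind) (by grind) (by grind) (by grind) t6 t3
    (by simp [l]) (by simp [l]) (by simp [l]) (by simp [l])
  obtain ⟨M3, i3, o31, -, -, -, k3⟩ := swap_step i2 r p c₁ c x s₂ n4 n22.symm
    (by grind) (by grind) (by grind) (by grind) t3 t2
    (by simp [l]) (by simp [l]) (by simp [l]) (by simp [l])
  obtain ⟨M4, i4, o41, -, -, -, k4⟩ := swap_step i3 r q c₂ f y s₁ n5 n10.symm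
    (by grind) (by grind) (by grind) (by grind) t4 t1
    (by simp [l]) (by simp [l]) (by simp [l]) (by simp [l])
  obtain ⟨M5, i5, o51, o52, -, -, k5⟩ := swap_step i4 r₁ r c₁ c₂ s₁ s₂ n1.symm n6
    (by grind) (by grind) (by grind) (by grind) t1 t2
    (by simp [l]) (by simp [l]) (by simp [l]) (by simp [l])
  refine GoodSwap.of_inv hS ?_ i5 (by grind) (by grind) (by grind)
  simp only [l, List.mem_toFinset, List.forall_mem_cons]
  simp [v1, v2, v3, v4, v5, v6, v7, v8, v9, v10, v11, v12, v13, v14, v15, v16] at *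
  simp [*]

/-! ### Positions and counting -/

/-- The column of symbol `s` in row `i`. -/
noncomputable def colOf {n : ℕ} {L : Fin n → Fin n → Fin n} (hL : IsLatinSquare L)
    (i s : Fin n) : Fin n := (Equiv.ofBijective _ (hL.1 i)).symm s

/-- The row of symbol `s` in column `j`. -/
noncomputable def rowOf {n : ℕ} {L : Fin n → Fin n → Fin n} (hL : IsLatinSquare L)
    (j s : Fin n) : Fin n := (Equiv.ofBijective _ (hL.2 j)).symm s

section Positions
variable {n : ℕ} {L : Fin n → Fin n → Fin n}

lemma L_colOf (hL : IsLatinSquare L) (i s : Fin n) : L i (colOf hL i s) = s :=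
  (Equiv.ofBijective _ (hL.1 i)).apply_symm_apply s

lemma L_rowOf (hL : IsLatinSquare L) (j s : Fin n) : L (rowOf hL j s) j = s :=
  (Equiv.ofBijective _ (hL.2 j)).apply_symm_apply s

lemma L_row_inj (hL : IsLatinSquare L) {i j j' : Fin n} (h : L i j = L i j') : j = j' := (hL.1 i).1 h

lemma L_col_inj (hL : IsLatinSquare L) {i i' j : Fin n} (h : L i j = L i' j) : i = i' := (hL.2 j).1 h

lemma colOf_inj_sym (hL : IsLatinSquare L) (i : Fin n) : Function.Injective (fun s => colOf hL i s) :=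
  (Equiv.ofBijective _ (hL.1 i)).symm.injective

lemma rowOf_inj_sym (hL : IsLatinSquare L) (j : Fin n) : Function.Injective (fun s => rowOf hL j s) :=
  (Equiv.ofBijective _ (hL.2 j)).symm.injective

lemma colOf_inj_row (hL : IsLatinSquare L) (s : Fin n) : Function.Injective (fun i => colOf hL i s) := by
  intro i i' h
  simp only at h
  apply L_col_inj hL (j := colOf hL i s)
  exact (L_colOf hL i s).trans ((L_colOf hL i' s).symm.trans (by rw [h]))

lemma rowOf_inj_col (hL : IsLatinSquare L) (s : Fin n) : Function.Injective (fun j => rowOf hL j s) := by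
  intro i i' h
  simp only at h
  apply L_row_inj hL (i := rowOf hL i s)
  exact (L_rowOf hL i s).trans ((L_rowOf hL i' s).symm.trans (by rw [h]))

end Positions

open Classical in
/-- Number of cells of row `i` with property `B`. -/
noncomputable def rowN {n : ℕ} (B : Fin n → Fin n → Prop) (i : Fin n) : ℕ :=
  (Finset.univ.filter fun j => B i j).card

open Classical in
/-- Number of cells of column `j` with property `B`. -/
noncomputable def colN {n : ℕ} (B : Fin n → Fin n → Prop) (j : Fin n) : ℕ :=
  (Finset.univ.filter fun i => B i j).card

open Classical in
/-- Number of cells containing `s` with property `B`. -/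
noncomputable def symN {n : ℕ} (L : Fin n → Fin n → Fin n) (B : Fin n → Fin n → Prop)
    (s : Fin n) : ℕ :=
  (Finset.univ.filter fun p : Fin n × Fin n => B p.1 p.2 ∧ L p.1 p.2 = s).card

open Classical in
/-- Total number of cells with property `B`. -/
noncomputable def totN {n : ℕ} (B : Fin n → Fin n → Prop) : ℕ :=
  (Finset.univ.filter fun p : Fin n × Fin n => B p.1 p.2).card

section Counting
open Classical
variable {n : ℕ}

lemma cnt_row (B : Fin n → Fin n → Prop) (i : Fin n) (f : Fin n → Fin n)
    (hf : Function.Injective f) :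
    (Finset.univ.filter fun a => B i (f a)).card ≤ rowN B i := by
  apply Finset.card_le_card_of_injOn f
  · intro a ha; simpa using ha
  · exact hf.injOn

lemma cnt_col (B : Fin n → Fin n → Prop) (j : Fin n) (f : Fin n → Fin n)
    (hf : Function.Injective f) :
    (Finset.univ.filter fun a => B (f a) j).card ≤ colN B j := by
  apply Finset.card_le_card_of_injOn f
  · intro a ha; simpa using ha
  · exact hf.injOn

lemma cnt_sym (L : Fin n → Fin n → Fin n) (B : Fin n → Fin n → Prop) (s : Fin n)
    (f g : Fin n → Fin n) (hfg : Function.Injective fun a => (f a, g a))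
    (hs : ∀ a, L (f a) (g a) = s) :
    (Finset.univ.filter fun a => B (f a) (g a)).card ≤ symN L B s := by
  apply Finset.card_le_card_of_injOn (fun a => (f a, g a))
  · intro a ha; simpa [hs] using ha
  · exact hfg.injOn

lemma cnt_T (T : Finset (Fin n)) (f : Fin n → Fin n) (hf : Function.Injective f) :
    (Finset.univ.filter fun a => f a ∈ T).card ≤ T.card := by
  apply Finset.card_le_card_of_injOn f
  · intro a ha; simpa using ha
  · exact hf.injOn

lemma rowN_or (D Q : Fin n → Fin n → Prop) (i : Fin n) :
    rowN (fun i j => D i j ∨ Q i j) i ≤ rowN D i + rowN Q i := by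
  unfold rowN; simp only [Finset.filter_or]; exact Finset.card_union_le _ _

lemma colN_or (D Q : Fin n → Fin n → Prop) (i : Fin n) :
    colN (fun i j => D i j ∨ Q i j) i ≤ colN D i + colN Q i := by
  unfold colN; simp only [Finset.filter_or]; exact Finset.card_union_le _ _

lemma symN_or (L : Fin n → Fin n → Fin n) (D Q : Fin n → Fin n → Prop) (i : Fin n) :
    symN L (fun i j => D i j ∨ Q i j) i ≤ symN L D i + symN L Q i := by
  unfold symN; simp only [or_and_right, Finset.filter_or]; exact Finset.card_union_le _ _

lemma sum_rowN (B : Fin n → Fin n → Prop) : ∑ i, rowN B i = totN B := by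
  unfold rowN totN
  simp only [Finset.card_filter]
  rw [Fintype.sum_prod_type]

lemma sum_colN (B : Fin n → Fin n → Prop) : ∑ i, colN B i = totN B := by
  unfold colN totN
  simp only [Finset.card_filter]
  rw [Fintype.sum_prod_type, Finset.sum_comm]

lemma sum_symN (L : Fin n → Fin n → Fin n) (B : Fin n → Fin n → Prop) :
    ∑ i, symN L B i = totN B := by
  unfold symN totN
  simp only [Finset.card_filter]
  rw [Finset.sum_comm]
  refine Finset.sum_congr rfl fun p _ => ?_
  by_cases h : B p.1 p.2 <;> simp [h]

lemma sum_comp_inj (N : Fin n → ℕ) (f : Fin n → Fin n) (hf : Function.Injective f) :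
    ∑ a, N (f a) = ∑ a, N a :=
  Function.Bijective.sum_comp (Finite.injective_iff_bijective.1 hf) N

/-- Few overloaded indices. -/
lemma cnt_over (N : Fin n → ℕ) (f : Fin n → Fin n) (hf : Function.Injective f) (δ K R : ℝ)
    (hδ : 0 < δ) (hK : ((∑ a, N a : ℕ) : ℝ) ≤ K) (hR : K = R * δ) :
    ((Finset.univ.filter fun a => δ < (N (f a) : ℝ)).card : ℝ) ≤ R := by
  have h1 : ((Finset.univ.filter fun a => δ < (N (f a) : ℝ)).card : ℝ) * δ ≤ K := by
    refine le_trans ?_ hK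
    rw [← sum_comp_inj N f hf]
    push_cast
    calc _ = ∑ a ∈ Finset.univ.filter (fun a => δ < (N (f a) : ℝ)), δ := by simp
      _ ≤ ∑ a ∈ Finset.univ.filter (fun a => δ < (N (f a) : ℝ)), (N (f a) : ℝ) :=
          Finset.sum_le_sum fun a ha => by simp at ha; exact ha.le
      _ ≤ _ := Finset.sum_le_sum_of_subset_of_nonneg (Finset.subset_univ _)
          (fun _ _ _ => by positivity)
  rw [hR] at h1
  exact le_of_mul_le_mul_right h1 hδ

/-- Union of a list of finsets. -/
noncomputable def bigU (l : List (Finset (Fin n))) : Finset (Fin n) := l.foldr (· ∪ ·) ∅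

lemma card_bigU (l : List (Finset (Fin n))) :
    ((bigU l).card : ℝ) ≤ (l.map fun s => (s.card : ℝ)).sum := by
  induction l with
  | nil => simp [bigU]
  | cons s l ih =>
    have : bigU (s :: l) = s ∪ bigU l := rfl
    rw [this, List.map_cons, List.sum_cons]
    have := Finset.card_union_le s (bigU l)
    have h : ((s ∪ bigU l).card : ℝ) ≤ s.card + (bigU l).card := by exact_mod_cast this
    linarith

lemma mem_bigU (l : List (Finset (Fin n))) (a : Fin n) : a ∈ bigU l ↔ ∃ s ∈ l, a ∈ s := by
  induction l with
  | nil => simp [bigU]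
  | cons s l ih =>
    have : bigU (s :: l) = s ∪ bigU l := rfl
    rw [this, Finset.mem_union, ih]; simp

lemma exists_avoid (U V : Finset (Fin n)) (h : (V.card : ℝ) < U.card) : ∃ a ∈ U, a ∉ V :=
  Finset.exists_mem_notMem_of_card_lt_card (by exact_mod_cast h)

lemma card_half_lt (m : ℕ) : (Finset.univ.filter fun i : Fin (2 * m) => i.val < m).card = m := by
  rw [Fin.card_filter_val_lt]; omega

lemma card_half (m : ℕ) (q : Prop) :
    (Finset.univ.filter fun i : Fin (2 * m) => ¬ (i.val < m ↔ q)).card = m := by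
  have h := card_half_lt m
  by_cases hq : q
  · simp only [hq, iff_true]
    have h2 := Finset.card_filter_add_card_filter_not (s := (Finset.univ : Finset (Fin (2 * m))))
      (fun i => i.val < m)
    simp only [Finset.card_univ, Fintype.card_fin] at h2
    convert (by omega : (Finset.univ.filter fun i : Fin (2 * m) => ¬ (i.val < m)).card = m)
  · simp only [hq, iff_false, not_not]; convert h

lemma exists_half (m : ℕ) (q : Prop) :
    ∃ U : Finset (Fin (2 * m)), U.card = m ∧ ∀ i, i ∈ U ↔ ¬ (i.val < m ↔ q) :=
  ⟨_, card_half m q, by simp⟩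

lemma parity_bits {R p C₁ C E G t K S X : Prop} (a3 : S ↔ (p ↔ C₁)) (a5 : X ↔ (R ↔ C₁))
    (a7 : S ↔ (R ↔ E)) (a9 : X ↔ (p ↔ G)) (a1 : S ↔ (t ↔ C)) (a2 : X ↔ (K ↔ C))
    (hp : R ↔ p) (hc : ¬ (C ↔ C₁)) :
    ¬ (R ↔ t) ∧ ¬ (p ↔ K) ∧ ¬ (C ↔ E) ∧ ¬ (C ↔ G) := by
  by_cases h1 : p <;> by_cases h2 : C₁ <;> simp_all

lemma iff_of_not_iff {x p q : Prop} (h1 : ¬ (x ↔ p)) (h2 : ¬ (p ↔ q)) : (x ↔ q) := by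
  tauto

end Counting

/-! ### The two cases -/

/-- Cells where `L` disagrees with the Chetwynd–Häggkvist square. -/
def Dcell {m : ℕ} (L : Fin (2 * m) → Fin (2 * m) → Fin (2 * m)) (i j : Fin (2 * m)) : Prop :=
  L i j ≠ CHsq m i j

/-- Cells where `L` agrees with `P`. -/
def Qcell {n : ℕ} (L : Fin n → Fin n → Fin n) (P : Fin n → Fin n → Option (Fin n))
    (i j : Fin n) : Prop := P i j = some (L i j)

/-- Cells that must be avoided. -/
def Bcell {m : ℕ} (L : Fin (2 * m) → Fin (2 * m) → Fin (2 * m))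
    (P : Fin (2 * m) → Fin (2 * m) → Option (Fin (2 * m))) (i j : Fin (2 * m)) : Prop :=
  Dcell L i j ∨ Qcell L P i j

/-- The standing assumptions. -/
structure SwapCtx (m : ℕ) (L : Fin (2 * m) → Fin (2 * m) → Fin (2 * m))
    (P : Fin (2 * m) → Fin (2 * m) → Option (Fin (2 * m))) (T : Finset (Fin (2 * m)))
    (δ η : ℝ) (a : ℕ) : Prop where
  lat : IsLatinSquare L
  qrow : ∀ i, (rowN (Qcell L P) i : ℝ) ≤ η
  qcol : ∀ i, (colN (Qcell L P) i : ℝ) ≤ η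
  qsym : ∀ i, (symN L (Qcell L P) i : ℝ) ≤ η
  hT : T.card = a
  hδ : 0 < δ
  h2 : 6 + 6 * δ + 6 * η + 2 * a ≤ (m : ℝ)

section Cases
open Classical
variable {m : ℕ} {L : Fin (2 * m) → Fin (2 * m) → Fin (2 * m)}
  {P : Fin (2 * m) → Fin (2 * m) → Option (Fin (2 * m))} {T : Finset (Fin (2 * m))}
  {δ η : ℝ} {a : ℕ}

lemma half_of_good {i j : Fin (2 * m)} (h : ¬ Bcell L P i j) :
    ((L i j).val < m ↔ (i.val < m ↔ j.val < m)) := by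
  have : L i j = CHsq m i j := by
    by_contra h'; exact h (Or.inl h')
  rw [this]; exact CH_half m i j

lemma CH_of_good {i j : Fin (2 * m)} (h : ¬ Bcell L P i j) : L i j = CHsq m i j := by
  by_contra h'; exact h (Or.inl h')

lemma Q_of_good {i j : Fin (2 * m)} (h : ¬ Bcell L P i j) : P i j ≠ some (L i j) :=
  fun h' => h (Or.inr h')

lemma good_intercalate {i i' j j' : Fin (2 * m)} (h1 : ¬ Bcell L P i j) (h2 : ¬ Bcell L P i j')
    (h3 : ¬ Bcell L P i' j) (h4 : ¬ Bcell L P i' j')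
    (hi : ¬ (i.val < m ↔ i'.val < m)) (h : L i j' = L i' j) : L i j = L i' j' := by
  have a1 := half_of_good h2
  have a2 := half_of_good h3
  rw [CH_of_good h1, CH_of_good h4]
  apply CH_intercalate m i i' j j' hi
  · rw [h] at a1; tauto
  · rw [← CH_of_good h2, ← CH_of_good h3, h]

lemma good_corner {i i' j j' k : Fin (2 * m)} (h1 : ¬ Bcell L P i k) (h2 : ¬ Bcell L P i j')
    (h3 : ¬ Bcell L P i' j) (h4 : ¬ Bcell L P i' j')
    (hi : ¬ (i.val < m ↔ i'.val < m)) (h : L i j' = L i' j) (hk : L i k = L i' j') : k = j := by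
  have a1 := half_of_good h2
  have a2 := half_of_good h3
  apply CH_inj m i
  rw [← CH_of_good h1, hk, CH_of_good h4]
  symm
  apply CH_intercalate m i i' j j' hi
  · rw [h] at a1; tauto
  · rw [← CH_of_good h2, ← CH_of_good h3, h]

lemma SwapCtx.brow (H : SwapCtx m L P T δ η a) (i : Fin (2 * m)) (f : Fin (2 * m) → Fin (2 * m))
    (hf : Function.Injective f) :
    ((Finset.univ.filter fun b => Bcell L P i (f b)).card : ℝ) ≤ rowN (Dcell L) i + η := by
  have h1 := cnt_row (Bcell L P) i f hf
  have h2 : rowN (Bcell L P) i ≤ _ := rowN_or (Dcell L) (Qcell L P) i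
  have h3 := H.qrow i
  have h4 : ((Finset.univ.filter fun b => Bcell L P i (f b)).card : ℝ)
    ≤ rowN (Dcell L) i + rowN (Qcell L P) i := by exact_mod_cast h1.trans h2
  linarith

lemma SwapCtx.bcol (H : SwapCtx m L P T δ η a) (i : Fin (2 * m)) (f : Fin (2 * m) → Fin (2 * m))
    (hf : Function.Injective f) :
    ((Finset.univ.filter fun b => Bcell L P (f b) i).card : ℝ) ≤ colN (Dcell L) i + η := by
  have h1 := cnt_col (Bcell L P) i f hf
  have h2 : colN (Bcell L P) i ≤ _ := colN_or (Dcell L) (Qcell L P) i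
  have h3 := H.qcol i
  have h4 : ((Finset.univ.filter fun b => Bcell L P (f b) i).card : ℝ)
    ≤ colN (Dcell L) i + colN (Qcell L P) i := by exact_mod_cast h1.trans h2
  linarith

lemma SwapCtx.bsym (H : SwapCtx m L P T δ η a) (s : Fin (2 * m)) (f g : Fin (2 * m) → Fin (2 * m))
    (hfg : Function.Injective fun b => (f b, g b)) (hs : ∀ b, L (f b) (g b) = s) :
    ((Finset.univ.filter fun b => Bcell L P (f b) (g b)).card : ℝ) ≤ symN L (Dcell L) s + η := by
  have h1 := cnt_sym L (Bcell L P) s f g hfg hs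
  have h2 : symN L (Bcell L P) s ≤ _ := symN_or L (Dcell L) (Qcell L P) s
  have h3 := H.qsym s
  have h4 : ((Finset.univ.filter fun b => Bcell L P (f b) (g b)).card : ℝ)
    ≤ symN L (Dcell L) s + symN L (Qcell L P) s := by exact_mod_cast h1.trans h2
  linarith

lemma SwapCtx.bT (H : SwapCtx m L P T δ η a) (f : Fin (2 * m) → Fin (2 * m))
    (hf : Function.Injective f) :
    ((Finset.univ.filter fun b => f b ∈ T).card : ℝ) ≤ a := by
  have h1 := cnt_T T f hf
  rw [H.hT] at h1
  exact_mod_cast h1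

/-- Conditions on the columns `c₁`, `c₂` (with `p`, `q` the rows of the swapped symbols) and on
the auxiliary row `r`, common to both cases. -/
structure RowOK (L : Fin (2 * m) → Fin (2 * m) → Fin (2 * m))
    (P : Fin (2 * m) → Fin (2 * m) → Option (Fin (2 * m))) (T : Finset (Fin (2 * m)))
    (r₁ c₁ c₂ p q r e f g g' : Fin (2 * m)) : Prop where
  v3 : L p c₁ = L r₁ c₂
  v4 : L q c₂ = L r₁ c₁
  v7 : L r e = L r₁ c₂
  v8 : L r f = L r₁ c₁
  v9 : L p g = L r c₁
  v10 : L q g' = L r c₂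
  t1 : L r₁ c₁ ∉ T
  t2 : L r₁ c₂ ∉ T
  t3 : L r c₁ ∉ T
  t4 : L r c₂ ∉ T
  n1 : r ≠ r₁
  n4 : r ≠ p
  n5 : r ≠ q
  n6 : c₁ ≠ c₂
  b1 : P r₁ c₁ ≠ some (L r₁ c₁)
  b2 : P r₁ c₂ ≠ some (L r₁ c₂)
  b3 : ¬ Bcell L P p c₁
  b4 : ¬ Bcell L P q c₂
  b5 : ¬ Bcell L P r c₁
  b6 : ¬ Bcell L P r c₂
  b7 : ¬ Bcell L P r e
  b8 : ¬ Bcell L P r f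
  b9 : ¬ Bcell L P p g
  b10 : ¬ Bcell L P q g'

lemma RowOK.symm {r₁ c₁ c₂ p q r e f g g' : Fin (2 * m)}
    (h : RowOK L P T r₁ c₁ c₂ p q r e f g g') : RowOK L P T r₁ c₂ c₁ q p r f e g' g :=
  ⟨h.v4, h.v3, h.v8, h.v7, h.v10, h.v9, h.t2, h.t1, h.t4, h.t3, h.n1, h.n5, h.n4, h.n6.symm,
    h.b2, h.b1, h.b4, h.b3, h.b6, h.b5, h.b8, h.b7, h.b10, h.b9⟩

lemma RowOK.ne (hL : IsLatinSquare L) {r₁ c₁ c₂ p q r e f g g' : Fin (2 * m)}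
    (h : RowOK L P T r₁ c₁ c₂ p q r e f g g') :
    p ≠ r₁ ∧ q ≠ r₁ ∧ e ≠ c₁ ∧ e ≠ c₂ ∧ f ≠ c₁ ∧ f ≠ c₂ ∧ e ≠ f ∧ g ≠ c₁ := by
  obtain ⟨v3, v4, v7, v8, v9, v10, -, -, -, -, n1, n4, n5, n6, -⟩ := h
  refine ⟨?_, ?_, ?_, ?_, ?_, ?_, ?_, ?_⟩ <;> rintro rfl
  · exact n6 (L_row_inj hL v3)
  · exact n6 (L_row_inj hL v4).symm
  · exact n4 (L_col_inj hL (v7.trans v3.symm))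
  · exact n1 (L_col_inj hL v7)
  · exact n1 (L_col_inj hL v8)
  · exact n5 (L_col_inj hL (v8.trans v4.symm))
  · exact n6 (L_row_inj hL (v8.symm.trans v7))
  · exact n4 (L_col_inj hL v9).symm

lemma case_ten (hL : IsLatinSquare L) {r₁ c₁ c₂ p q r e f g g' : Fin (2 * m)}
    (h : RowOK L P T r₁ c₁ c₂ p q r e f g g')
    (hp : ¬ (r.val < m ↔ p.val < m)) (hq : ¬ (r.val < m ↔ q.val < m)) :
    GoodSwap L P T r₁ c₁ c₂ := by
  obtain ⟨m1, m2, m3, m4, m5, m6, m7, m8⟩ := h.ne hL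
  have e1 : e = g := good_corner h.b7 h.b5 h.b9 h.b3 hp h.v9.symm (h.v7.trans h.v3.symm)
  have e2 : f = g' := good_corner h.b8 h.b6 h.b10 h.b4 hq h.v10.symm (h.v8.trans h.v4.symm)
  subst e1 e2
  exact trade_ten L hL P T r₁ c₁ c₂ p q r e f _ _ _ _ rfl rfl h.v3 h.v4 rfl rfl h.v7 h.v8 h.v9
    h.v10 h.t1 h.t2 h.t3 h.t4 h.n1 m1 m2 h.n4 h.n5 h.n6 m3 m4 m5 m6 m7 h.b1 h.b2
    (Q_of_good h.b3) (Q_of_good h.b4) (Q_of_good h.b5) (Q_of_good h.b6) (Q_of_good h.b7)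
    (Q_of_good h.b8) (Q_of_good h.b9) (Q_of_good h.b10)

lemma case_sixteen (H : SwapCtx m L P T δ η a) {r₁ c₁ c₂ p q r e f g g' : Fin (2 * m)}
    (h : RowOK L P T r₁ c₁ c₂ p q r e f g g')
    (hp : (r.val < m ↔ p.val < m)) (hq : ¬ (r.val < m ↔ q.val < m))
    (o1 : (rowN (Dcell L) p : ℝ) ≤ δ) (o2 : (symN L (Dcell L) (L r₁ c₂) : ℝ) ≤ δ)
    (o3 : (rowN (Dcell L) r : ℝ) + symN L (Dcell L) (L r c₁) + colN (Dcell L) e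
      + colN (Dcell L) g ≤ 7 / 4 * δ) :
    GoodSwap L P T r₁ c₁ c₂ := by
  have hL := H.lat
  obtain ⟨m1, m2, m3, m4, m5, m6, m7, m8⟩ := h.ne hL
  have e2 : f = g' := good_corner h.b8 h.b6 h.b10 h.b4 hq h.v10.symm (h.v8.trans h.v4.symm)
  subst e2
  set s₂ := L r₁ c₂ with hs₂
  set x := L r c₁ with hx
  let l : List (Finset (Fin (2 * m))) :=
    [Finset.univ.filter fun c => Bcell L P r c,
     Finset.univ.filter fun c => Bcell L P p c,
     Finset.univ.filter fun c => Bcell L P (rowOf hL c s₂) c,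
     Finset.univ.filter fun c => Bcell L P (rowOf hL c s₂) e,
     Finset.univ.filter fun c => Bcell L P (rowOf hL c x) c,
     Finset.univ.filter fun c => Bcell L P (rowOf hL c x) g,
     Finset.univ.filter fun c => L r c ∈ T,
     Finset.univ.filter fun c => L p c ∈ T,
     {c₂}, {f}, {colOf hL q x}, {colOf hL r₁ x}]
  have hcard := card_bigU l
  simp only [l, List.map_cons, List.map_nil, List.sum_cons, List.sum_nil,
    Finset.card_singleton] at hcard
  have k1 := H.brow r (fun c => c) (fun _ _ h => h)
  have k2 := H.brow p (fun c => c) (fun _ _ h => h)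
  have k3 := H.bsym s₂ (fun c => rowOf hL c s₂) (fun c => c)
    (fun _ _ h => (Prod.ext_iff.1 h).2) (fun c => L_rowOf hL c s₂)
  have k4 := H.bcol e (fun c => rowOf hL c s₂) (rowOf_inj_col hL s₂)
  have k5 := H.bsym x (fun c => rowOf hL c x) (fun c => c)
    (fun _ _ h => (Prod.ext_iff.1 h).2) (fun c => L_rowOf hL c x)
  have k6 := H.bcol g (fun c => rowOf hL c x) (rowOf_inj_col hL x)
  have k7 := H.bT (L r) (hL.1 r).1
  have k8 := H.bT (L p) (hL.1 p).1
  have hδ := H.hδ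
  have h2 := H.h2
  obtain ⟨U, hU1, hU2⟩ := exists_half m (c₁.val < m)
  obtain ⟨c, hc, hcl⟩ := exists_avoid U (bigU l) (by
      rw [hU1]
      push_cast at hcard
      linarith)
  rw [mem_bigU] at hcl
  rw [hU2] at hc
  simp only [l, List.mem_cons, List.not_mem_nil, or_false, exists_eq_or_imp, exists_eq_left,
    Finset.mem_filter, Finset.mem_univ, true_and, Finset.mem_singleton, not_or] at hcl
  obtain ⟨w1, w2, w3, w4, w5, w6, w7, w8, w9, w10, w11, w12⟩ := hcl
  have vt := L_rowOf hL c s₂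
  have vk := L_rowOf hL c x
  set t := rowOf hL c s₂ with ht
  set k := rowOf hL c x with hk
  have a3 := half_of_good h.b3
  have a5 := half_of_good h.b5
  have a7 := half_of_good h.b7
  have a9 := half_of_good h.b9
  have at' := half_of_good w3
  have ak' := half_of_good w5
  rw [h.v3] at a3
  rw [h.v7] at a7
  rw [h.v9] at a9
  rw [vt] at at'
  rw [vk] at ak'
  simp only [← hs₂, ← hx] at a3 a5 a7 a9
  obtain ⟨htr, hkp, hce', hcg'⟩ := parity_bits a3 a5 a7 a9 at' ak' hp hc
  have hce : c ≠ e := by intro h'; rw [h'] at hce'; exact hce' Iff.rfl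
  have hcg : c ≠ g := by intro h'; rw [h'] at hcg'; exact hcg' Iff.rfl
  have hc1 : c ≠ c₁ := by intro h'; rw [h'] at hc; exact hc Iff.rfl
  have xs : x ≠ s₂ := fun h' => h.n4 (L_col_inj hL (h'.trans h.v3.symm))
  have vte : L r c = L t e := good_intercalate w1 h.b7 w3 w4 htr (h.v7.trans vt.symm)
  have vkg : L p c = L k g := good_intercalate w2 h.b9 w5 w6 hkp (h.v9.trans vk.symm)
  refine trade_sixteen L hL P T r₁ c₁ c₂ p q r e f g c t k _ _ _ _ (L r c) (L p c) rfl rfl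
    h.v3 h.v4 rfl rfl h.v7 h.v8 h.v9 h.v10 rfl rfl vt vte.symm vk vkg.symm
    h.t1 h.t2 h.t3 h.t4 w7 w8 h.n1 m1 m2 h.n4 h.n5 ?_ ?_ ?_ ?_ ?_ ?_ ?_ ?_ ?_
    h.n6 m3 m4 m5 m6 m7 m8 hc1 w9 hce w10 hcg h.b1 h.b2
    (Q_of_good h.b3) (Q_of_good h.b4) (Q_of_good h.b5) (Q_of_good h.b6) (Q_of_good h.b7)
    (Q_of_good h.b8) (Q_of_good h.b9) (Q_of_good h.b10)
    (Q_of_good w1) (Q_of_good w2) (Q_of_good w3) (Q_of_good w4) (Q_of_good w5) (Q_of_good w6)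
  · intro h'; rw [h'] at hp; exact hq hp
  · intro h'; rw [h'] at vt; exact w9 (L_row_inj hL vt)
  · intro h'; rw [h'] at vk; exact w12 (L_row_inj hL (vk.trans (L_colOf hL r₁ x).symm))
  · intro h'; rw [h'] at htr; exact htr Iff.rfl
  · intro h'; rw [h'] at hkp; exact hkp Iff.rfl
  · intro h'; rw [h'] at vk; exact hc1 (L_row_inj hL vk)
  · intro h'; rw [h'] at vk; exact xs (vk.symm.trans vt)
  · intro h'; rw [← h'] at vt; exact hc1 (L_row_inj hL (vt.trans h.v3.symm))
  · intro h'; rw [h'] at vk; exact w11 (L_row_inj hL (vk.trans (L_colOf hL q x).symm))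

end Cases

section Final
open Classical
variable {m : ℕ} {L : Fin (2 * m) → Fin (2 * m) → Fin (2 * m)}
  {P : Fin (2 * m) → Fin (2 * m) → Option (Fin (2 * m))} {T : Finset (Fin (2 * m))}
  {δ η : ℝ} {a : ℕ}

lemma swap_of_columns (H : SwapCtx m L P T δ η a) (R : ℝ) (hR : 0 < R)
    (hD : (totN (Dcell L) : ℝ) ≤ R * δ)
    (h1 : 3 + 4 * R + 6 * δ + 6 * η + 3 * a ≤ 2 * (m : ℝ))
    (r₁ c₁ c₂ p q : Fin (2 * m)) (n6 : c₁ ≠ c₂)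
    (v3 : L p c₁ = L r₁ c₂) (v4 : L q c₂ = L r₁ c₁)
    (t1 : L r₁ c₁ ∉ T) (t2 : L r₁ c₂ ∉ T)
    (b1 : P r₁ c₁ ≠ some (L r₁ c₁)) (b2 : P r₁ c₂ ≠ some (L r₁ c₂))
    (b3 : ¬ Bcell L P p c₁) (b4 : ¬ Bcell L P q c₂)
    (o1 : (colN (Dcell L) c₁ : ℝ) ≤ δ) (o2 : (colN (Dcell L) c₂ : ℝ) ≤ δ)
    (o3 : (symN L (Dcell L) (L r₁ c₁) : ℝ) ≤ δ) (o4 : (symN L (Dcell L) (L r₁ c₂) : ℝ) ≤ δ)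
    (o5 : (rowN (Dcell L) p : ℝ) ≤ δ) (o6 : (rowN (Dcell L) q : ℝ) ≤ δ) :
    GoodSwap L P T r₁ c₁ c₂ := by
  have hL := H.lat
  have hδ := H.hδ
  have h2 := H.h2
  set s₁ := L r₁ c₁ with hs₁
  set s₂ := L r₁ c₂ with hs₂
  let l : List (Finset (Fin (2 * m))) :=
    [Finset.univ.filter fun r => Bcell L P r c₁,
     Finset.univ.filter fun r => Bcell L P r c₂,
     Finset.univ.filter fun r => Bcell L P r (colOf hL r s₂),
     Finset.univ.filter fun r => Bcell L P r (colOf hL r s₁),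
     Finset.univ.filter fun r => Bcell L P p (colOf hL p (L r c₁)),
     Finset.univ.filter fun r => Bcell L P q (colOf hL q (L r c₂)),
     Finset.univ.filter fun r => L r c₁ ∈ T,
     Finset.univ.filter fun r => L r c₂ ∈ T,
     {r₁}, {p}, {q}]
  have hcard := card_bigU l
  have ig : Function.Injective fun r => colOf hL p (L r c₁) :=
    (colOf_inj_sym hL p).comp (hL.2 c₁).1
  have ig' : Function.Injective fun r => colOf hL q (L r c₂) :=
    (colOf_inj_sym hL q).comp (hL.2 c₂).1
  have k1 := H.bcol c₁ (fun c => c) (fun _ _ h => h)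
  have k2 := H.bcol c₂ (fun c => c) (fun _ _ h => h)
  have k3 := H.bsym s₂ (fun c => c) (fun c => colOf hL c s₂)
    (fun _ _ h => (Prod.ext_iff.1 h).1) (fun c => L_colOf hL c s₂)
  have k4 := H.bsym s₁ (fun c => c) (fun c => colOf hL c s₁)
    (fun _ _ h => (Prod.ext_iff.1 h).1) (fun c => L_colOf hL c s₁)
  have k5 := H.brow p _ ig
  have k6 := H.brow q _ ig'
  have k7 := H.bT (fun r => L r c₁) (hL.2 c₁).1
  have k8 := H.bT (fun r => L r c₂) (hL.2 c₂).1
  have hV : ((bigU l).card : ℝ) ≤ 6 * δ + 6 * η + 2 * a + 3 := by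
    simp only [l, List.map_cons, List.map_nil, List.sum_cons, List.sum_nil,
      Finset.card_singleton] at hcard
    push_cast at hcard
    linarith
  have hok : ∀ r, r ∉ bigU l → RowOK L P T r₁ c₁ c₂ p q r (colOf hL r s₂) (colOf hL r s₁)
      (colOf hL p (L r c₁)) (colOf hL q (L r c₂)) := by
    intro r hr
    rw [mem_bigU] at hr
    simp only [l, List.mem_cons, List.not_mem_nil, or_false, exists_eq_or_imp, exists_eq_left,
      Finset.mem_filter, Finset.mem_univ, true_and, Finset.mem_singleton, not_or] at hr
    obtain ⟨w1, w2, w3, w4, w5, w6, w7, w8, w9, w10, w11⟩ := hr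
    exact ⟨v3, v4, L_colOf hL _ _, L_colOf hL _ _, L_colOf hL _ _, L_colOf hL _ _, t1, t2, w7, w8,
      w9, w10, w11, n6, b1, b2, b3, b4, w1, w2, w3, w4, w5, w6⟩
  by_cases hpq : (p.val < m ↔ q.val < m)
  · obtain ⟨U, hU1, hU2⟩ := exists_half m (p.val < m)
    obtain ⟨r, hr, hrl⟩ := exists_avoid U (bigU l) (by rw [hU1]; linarith)
    rw [hU2] at hr
    exact case_ten hL (hok r hrl) hr (by rwa [← hpq])
  · let N : Fin (2 * m) → ℝ := fun r => (rowN (Dcell L) r : ℝ) + symN L (Dcell L) (L r c₁)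
      + symN L (Dcell L) (L r c₂) + colN (Dcell L) (colOf hL r s₂)
      + colN (Dcell L) (colOf hL r s₁) + colN (Dcell L) (colOf hL p (L r c₁))
      + colN (Dcell L) (colOf hL q (L r c₂))
    have hsum : ∑ r, N r = 7 * (totN (Dcell L) : ℝ) := by
      have e1 := sum_rowN (Dcell L)
      have e2 := (sum_comp_inj (symN L (Dcell L)) (fun r => L r c₁) (hL.2 c₁).1).trans
        (sum_symN L (Dcell L))
      have e3 := (sum_comp_inj (symN L (Dcell L)) (fun r => L r c₂) (hL.2 c₂).1).trans
        (sum_symN L (Dcell L))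
      have e4 := (sum_comp_inj (colN (Dcell L)) _ (colOf_inj_row hL s₂)).trans
        (sum_colN (Dcell L))
      have e5 := (sum_comp_inj (colN (Dcell L)) _ (colOf_inj_row hL s₁)).trans
        (sum_colN (Dcell L))
      have e6 := (sum_comp_inj (colN (Dcell L)) _ ig).trans (sum_colN (Dcell L))
      have e7 := (sum_comp_inj (colN (Dcell L)) _ ig').trans (sum_colN (Dcell L))
      simp only [N, Finset.sum_add_distrib]
      simp only [← Nat.cast_sum]
      rw [e1, e2, e3, e4, e5, e6, e7]
      ring
    let G : Finset (Fin (2 * m)) := Finset.univ \ bigU l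
    have hG : 4 * R ≤ (G.card : ℝ) := by
      have := Finset.le_card_sdiff (bigU l) (Finset.univ : Finset (Fin (2 * m)))
      rw [Finset.card_univ, Fintype.card_fin] at this
      have h' : (2 * m : ℝ) ≤ G.card + (bigU l).card := by
        have : 2 * m ≤ G.card + (bigU l).card := by simp only [G]; omega
        exact_mod_cast this
      have ha : (0 : ℝ) ≤ a := Nat.cast_nonneg a
      linarith
    have hGne : G.Nonempty := by
      rw [← Finset.card_pos]
      have : (0 : ℝ) < G.card := by linarith
      exact_mod_cast this
    obtain ⟨r, hr, hrN⟩ : ∃ r ∈ G, N r ≤ 7 / 4 * δ := by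
      apply Finset.exists_le_of_sum_le hGne
      calc ∑ r ∈ G, N r ≤ ∑ r, N r :=
            Finset.sum_le_sum_of_subset_of_nonneg (Finset.subset_univ _)
              (fun _ _ _ => by simp only [N]; positivity)
        _ = 7 * (totN (Dcell L) : ℝ) := hsum
        _ ≤ 7 * (R * δ) := by linarith
        _ = (4 * R) * (7 / 4 * δ) := by ring
        _ ≤ (G.card : ℝ) * (7 / 4 * δ) := by gcongr
        _ = ∑ r ∈ G, 7 / 4 * δ := by simp
    have hrl : r ∉ bigU l := by simpa [G] using hr
    have ok := hok r hrl
    simp only [N] at hrN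
    have z1 : (0 : ℝ) ≤ symN L (Dcell L) (L r c₁) := Nat.cast_nonneg _
    have z2 : (0 : ℝ) ≤ symN L (Dcell L) (L r c₂) := Nat.cast_nonneg _
    have z3 : (0 : ℝ) ≤ colN (Dcell L) (colOf hL r s₂) := Nat.cast_nonneg _
    have z4 : (0 : ℝ) ≤ colN (Dcell L) (colOf hL r s₁) := Nat.cast_nonneg _
    have z5 : (0 : ℝ) ≤ colN (Dcell L) (colOf hL p (L r c₁)) := Nat.cast_nonneg _
    have z6 : (0 : ℝ) ≤ colN (Dcell L) (colOf hL q (L r c₂)) := Nat.cast_nonneg _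
    by_cases hrp : (r.val < m ↔ p.val < m)
    · exact case_sixteen H ok hrp (by rwa [hrp]) o5 o4 (by linarith)
    · have hrq : (r.val < m ↔ q.val < m) := iff_of_not_iff hrp hpq
      exact (case_sixteen H ok.symm hrq hrp o6 o3 (by linarith)).symm

lemma swap_main (H : SwapCtx m L P T δ η a) (R : ℝ) (hR : 0 < R)
    (hD : (totN (Dcell L) : ℝ) ≤ R * δ)
    (h1 : 3 + 4 * R + 6 * δ + 6 * η + 3 * a ≤ 2 * (m : ℝ)) (r₁ : Fin (2 * m)) :
    ∃ C₁ : Finset (Fin (2 * m)), (C₁.card : ℝ) ≤ 2 * R + η + a ∧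
      ∀ c₁ ∉ C₁, ∃ C₂ : Finset (Fin (2 * m)),
        (C₂.card : ℝ) ≤ 4 * R + 2 * δ + 3 * η + a + 1 ∧
        ∀ c₂ ∉ C₂, GoodSwap L P T r₁ c₁ c₂ := by
  have hL := H.lat
  have hδ := H.hδ
  have idinj : Function.Injective fun c : Fin (2 * m) => c := fun _ _ h => h
  have sc : ((∑ c, colN (Dcell L) c : ℕ) : ℝ) ≤ R * δ := by rw [sum_colN]; exact hD
  have sr : ((∑ c, rowN (Dcell L) c : ℕ) : ℝ) ≤ R * δ := by rw [sum_rowN]; exact hD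
  have ss : ((∑ c, symN L (Dcell L) c : ℕ) : ℝ) ≤ R * δ := by rw [sum_symN]; exact hD
  have k1 := cnt_over (colN (Dcell L)) (fun c => c) idinj δ _ R hδ sc rfl
  have k2 := cnt_over (symN L (Dcell L)) (L r₁) (hL.1 r₁).1 δ _ R hδ ss rfl
  have k3 : ((Finset.univ.filter fun c => Qcell L P r₁ c).card : ℝ) ≤ η :=
    le_trans (by exact_mod_cast cnt_row (Qcell L P) r₁ (fun c => c) idinj) (H.qrow r₁)
  have k4 := H.bT (L r₁) (hL.1 r₁).1
  let l₁ : List (Finset (Fin (2 * m))) :=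
    [Finset.univ.filter fun c => δ < (colN (Dcell L) c : ℝ),
     Finset.univ.filter fun c => δ < (symN L (Dcell L) (L r₁ c) : ℝ),
     Finset.univ.filter fun c => Qcell L P r₁ c,
     Finset.univ.filter fun c => L r₁ c ∈ T]
  refine ⟨bigU l₁, ?_, ?_⟩
  · have hcard := card_bigU l₁
    simp only [l₁, List.map_cons, List.map_nil, List.sum_cons, List.sum_nil] at hcard
    linarith
  intro c₁ hc₁
  rw [mem_bigU] at hc₁
  simp only [l₁, List.mem_cons, List.not_mem_nil, or_false, exists_eq_or_imp, exists_eq_left,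
    Finset.mem_filter, Finset.mem_univ, true_and, not_or, not_lt] at hc₁
  obtain ⟨w1, w2, w3, w4⟩ := hc₁
  have ip : Function.Injective fun c => rowOf hL c₁ (L r₁ c) :=
    (rowOf_inj_sym hL c₁).comp (hL.1 r₁).1
  have iq : Function.Injective fun c => rowOf hL c (L r₁ c₁) := rowOf_inj_col hL _
  have k5 := cnt_over (rowN (Dcell L)) _ ip δ _ R hδ sr rfl
  have k6 := cnt_over (rowN (Dcell L)) _ iq δ _ R hδ sr rfl
  have k7 := H.bcol c₁ _ ip
  have k8 := H.bsym (L r₁ c₁) (fun c => rowOf hL c (L r₁ c₁)) (fun c => c)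
    (fun _ _ h => (Prod.ext_iff.1 h).2) (fun c => L_rowOf hL c _)
  let l₂ : List (Finset (Fin (2 * m))) :=
    [Finset.univ.filter fun c => δ < (rowN (Dcell L) (rowOf hL c₁ (L r₁ c)) : ℝ),
     Finset.univ.filter fun c => δ < (rowN (Dcell L) (rowOf hL c (L r₁ c₁)) : ℝ),
     Finset.univ.filter fun c => Bcell L P (rowOf hL c₁ (L r₁ c)) c₁,
     Finset.univ.filter fun c => Bcell L P (rowOf hL c (L r₁ c₁)) c,
     {c₁}]
  refine ⟨bigU (l₁ ++ l₂), ?_, ?_⟩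
  · have hcard := card_bigU (l₁ ++ l₂)
    simp only [l₁, l₂, List.cons_append, List.nil_append, List.map_cons, List.map_nil,
      List.sum_cons, List.sum_nil, Finset.card_singleton] at hcard ⊢
    push_cast at hcard
    linarith
  intro c₂ hc₂
  rw [mem_bigU] at hc₂
  simp only [l₁, l₂, List.cons_append, List.nil_append, List.mem_cons, List.not_mem_nil,
    or_false, exists_eq_or_imp, exists_eq_left, Finset.mem_singleton,
    Finset.mem_filter, Finset.mem_univ, true_and, not_or, not_lt] at hc₂
  obtain ⟨u1, u2, u3, u4, u5, u6, u7, u8, u9⟩ := hc₂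
  exact swap_of_columns H R hR hD h1 r₁ c₁ c₂ (rowOf hL c₁ (L r₁ c₂)) (rowOf hL c₂ (L r₁ c₁))
    (fun h => u9 h.symm) (L_rowOf hL _ _) (L_rowOf hL _ _) w4 u4 w3 u3 u7 u8 w1 u1 w2 u2 u5 u6

end Final

/-- Lemma 2 of the paper: let `L` be a latin square of order `n = 2m` differing
from the Chetwynd–Häggkvist square in at most `κn²` cells, `P` an `ε`-dense
partial latin square, and `T` a set of `a` forbidden symbols.  Then for every
row `r₁`, for all but at most `2(κ/d)n + εn + a` columns `c₁` and all but at
most `4(κ/d)n + 2dn + 3εn + a + 1` columns `c₂`, there is a trade on `L`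
changing at most 16 cells, avoiding cells where `P` and `L` agree and the
symbols of `T`, that swaps the symbols in `(r₁, c₁)` and `(r₁, c₂)`. -/
theorem swap_in_row_lemma (m : ℕ) (hm : 0 < m) (κ d ε : ℝ) (a : ℕ)
    (hκ : 0 < κ) (hd : 0 < d) (hε : 0 ≤ ε)
    (h1 : (3 : ℝ) ≤ (2 * m : ℝ) - 4 * (κ / d) * (2 * m) - 6 * d * (2 * m)
      - 6 * ε * (2 * m) - 3 * a)
    (h2 : (12 : ℝ) ≤ (2 * m : ℝ) - 12 * d * (2 * m) - 12 * ε * (2 * m) - 4 * a)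
    (L : Fin (2 * m) → Fin (2 * m) → Fin (2 * m)) (hL : IsLatinSquare L)
    (hdiff : ((Finset.univ.filter fun p : Fin (2 * m) × Fin (2 * m) =>
      L p.1 p.2 ≠ CHsq m p.1 p.2).card : ℝ) ≤ κ * (2 * m : ℝ) ^ 2)
    (P : Fin (2 * m) → Fin (2 * m) → Option (Fin (2 * m)))
    (hP : IsPartialLatinSquare P) (hPd : IsEpsDense ε P)
    (T : Finset (Fin (2 * m))) (hT : T.card = a)
    (r₁ : Fin (2 * m)) :
    ∃ C₁ : Finset (Fin (2 * m)),
      (C₁.card : ℝ) ≤ 2 * (κ / d) * (2 * m) + ε * (2 * m) + a ∧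
      ∀ c₁ ∉ C₁, ∃ C₂ : Finset (Fin (2 * m)),
        (C₂.card : ℝ) ≤ 4 * (κ / d) * (2 * m) + 2 * d * (2 * m)
          + 3 * ε * (2 * m) + a + 1 ∧
        ∀ c₂ ∉ C₂, ∃ L' : Fin (2 * m) → Fin (2 * m) → Fin (2 * m),
          IsLatinSquare L' ∧
          (Finset.univ.filter fun p : Fin (2 * m) × Fin (2 * m) =>
            L' p.1 p.2 ≠ L p.1 p.2).card ≤ 16 ∧
          (∀ i j, P i j = some (L i j) → L' i j = L i j) ∧
          (∀ i j, L' i j ≠ L i j → L i j ∉ T ∧ L' i j ∉ T) ∧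
          L' r₁ c₁ = L r₁ c₂ ∧ L' r₁ c₂ = L r₁ c₁ ∧
          ∀ c, c ≠ c₁ → c ≠ c₂ → L' r₁ c = L r₁ c := by
  classical
  have hmR : (0 : ℝ) < m := by exact_mod_cast hm
  have H : SwapCtx m L P T (d * (2 * m)) (ε * (2 * m)) a := by
    obtain ⟨p1, p2, p3⟩ := hPd
    push_cast at p1 p2 p3
    refine ⟨hL, ?_, ?_, ?_, hT, by positivity, by linarith⟩
    · intro i
      refine le_trans ?_ (p1 i)
      unfold rowN Qcell
      gcongr with j
      intro h; simp [h]
    · intro j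
      refine le_trans ?_ (p2 j)
      unfold colN Qcell
      gcongr with i
      intro h; simp [h]
    · intro s
      refine le_trans ?_ (p3 s)
      unfold symN Qcell
      gcongr with q
      rintro ⟨h, h'⟩; rw [h, h']
  have hD : (totN (Dcell L) : ℝ) ≤ (κ / d * (2 * m)) * (d * (2 * m)) := by
    have e : (κ / d * (2 * m)) * (d * (2 * m)) = κ * (2 * m : ℝ) ^ 2 := by field_simp
    rw [e]
    refine le_trans (le_of_eq ?_) hdiff
    unfold totN Dcell
    congr!
  obtain ⟨C₁, hC₁, h⟩ := swap_main H (κ / d * (2 * m)) (by positivity) hD (by linarith) r₁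
  refine ⟨C₁, by linarith, fun c₁ hc₁ => ?_⟩
  obtain ⟨C₂, hC₂, h'⟩ := h c₁ hc₁
  exact ⟨C₂, by linarith, fun c₂ hc₂ => h' c₂ hc₂⟩
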